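/- arXiv:2408.10002 — 7 statements merged into one kernel-verified Lean document; each statement's English description precedes it below -/
import Mathlib

section
/- Let I be a nonempty finite index set and let a : I → ℝ and b : I → ℝ satisfy a i > 0 and b i > 0 for all i ∈ I. Then min_{i∈I} min(a i / b i, b i / a i) ≤ min( (Σ_{i∈I} a i)/(Σ_{i∈I} b i), (Σ_{i∈I} b i)/(Σ_{i∈I} a i) ). -/
/-- A common lower bound of the ratios `f i / g i` is a lower bound of their mediant. -/
theorem le_sum_div_sum {ι : Type*} (s : Finset ι) (hs : s.Nonempty) (f g : ι → ℝ) (c : ℝ)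
    (hg : ∀ i ∈ s, 0 < g i) (h : ∀ i ∈ s, c ≤ f i / g i) :
    c ≤ (∑ i ∈ s, f i) / (∑ i ∈ s, g i) := by
  rw [le_div_iff₀ (Finset.sum_pos hg hs), Finset.mul_sum]
  exact Finset.sum_le_sum fun i hi => (le_div_iff₀ (hg i hi)).mp (h i hi)

/-- Mergeability of the Balance objective for a nonempty finite family of clusters:
the balance `min(Σa/Σb, Σb/Σa)` of the merged cluster is at least the minimum
balance `min(a i / b i, b i / a i)` over the clusters being merged. -/
theorem balance_merge_family {ι : Type*} (I : Finset ι) (hI : I.Nonempty)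
    (a b : ι → ℝ) (ha : ∀ i ∈ I, 0 < a i) (hb : ∀ i ∈ I, 0 < b i) :
    I.inf' hI (fun i => min (a i / b i) (b i / a i)) ≤
      min ((∑ i ∈ I, a i) / (∑ i ∈ I, b i)) ((∑ i ∈ I, b i) / (∑ i ∈ I, a i)) := by
  have key := fun i (hi : i ∈ I) =>
    le_min_iff.mp (I.inf'_le (fun i => min (a i / b i) (b i / a i)) hi)
  exact le_min (le_sum_div_sum I hI a b _ hb fun i hi => (key i hi).1)
    (le_sum_div_sum I hI b a _ ha fun i hi => (key i hi).2)
end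

section
/- Fix real numbers α and β and define Δ(r) := max(0, max(β − r, r − α)) for r ∈ ℝ. Let I be a nonempty finite index set, g : I → J a function into a finite index set J, and s : I → ℝ, t : I → ℝ with s i ≥ 0 and t i > 0 for all i. For j ∈ J define v j := Δ( (Σ_{i : g i = j} s i)/(Σ_{i : g i = j} t i) ) if the fiber g⁻¹(j) is nonempty, and v j := 0 otherwise. Then for every j ∈ J, v j ≤ max_{i∈I} Δ(s i / t i). -/
/-- The proportional violation of a ratio `r` with respect to bounds `α`, `β`. -/
noncomputable def propViol (α β r : ℝ) : ℝ := max 0 (max (β - r) (r - α))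

theorem propViol_nonneg (α β r : ℝ) : 0 ≤ propViol α β r :=
  le_max_left _ _

theorem propViol_le_iff {α β r M : ℝ} (hM : 0 ≤ M) :
    propViol α β r ≤ M ↔ β - M ≤ r ∧ r ≤ α + M := by
  simp only [propViol, max_le_iff, hM, true_and, sub_le_comm, sub_le_iff_le_add']

/-- The violation of an aggregated ratio is at most any common bound on the violations of the
individual ratios. -/
theorem propViol_sum_div_sum_le {ι : Type*} {F : Finset ι} (hF : F.Nonempty) {α β M : ℝ}
    {s t : ι → ℝ} (ht : ∀ i ∈ F, 0 < t i) (h : ∀ i ∈ F, propViol α β (s i / t i) ≤ M) :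
    propViol α β ((∑ i ∈ F, s i) / ∑ i ∈ F, t i) ≤ M := by
  obtain ⟨i₀, hi₀⟩ := hF
  have hM : 0 ≤ M := (propViol_nonneg _ _ _).trans (h i₀ hi₀)
  have hT : 0 < ∑ i ∈ F, t i := Finset.sum_pos ht ⟨i₀, hi₀⟩
  rw [propViol_le_iff hM, le_div_iff₀ hT, div_le_iff₀ hT, Finset.mul_sum, Finset.mul_sum]
  exact ⟨Finset.sum_le_sum fun i hi =>
      (le_div_iff₀ (ht i hi)).1 ((propViol_le_iff hM).1 (h i hi)).1,
    Finset.sum_le_sum fun i hi =>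
      (div_le_iff₀ (ht i hi)).1 ((propViol_le_iff hM).1 (h i hi)).2⟩

/-- Mergeability of the Group Utilitarian / Group Egalitarian objectives: under a
merge map `g : I → J`, the proportional violation of each merged cluster (with
violation `0` for empty merged clusters) is at most the maximum proportional
violation over the original clusters. -/
theorem propViol_max_merge {I J : Type*} [Fintype I] [Nonempty I] [Fintype J]
    [DecidableEq J] (α β : ℝ) (g : I → J) (s t : I → ℝ)
    (hs : ∀ i, 0 ≤ s i) (ht : ∀ i, 0 < t i) (v : J → ℝ)
    (hv : ∀ j : J, v j =
      if (Finset.univ.filter (fun i => g i = j)).Nonempty then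
        propViol α β ((∑ i ∈ Finset.univ.filter (fun i => g i = j), s i) /
          (∑ i ∈ Finset.univ.filter (fun i => g i = j), t i))
      else 0) :
    ∀ j : J, v j ≤ Finset.univ.sup' Finset.univ_nonempty
      (fun i => propViol α β (s i / t i)) := by
  have hle (i : I) : propViol α β (s i / t i) ≤ Finset.univ.sup' Finset.univ_nonempty
      (fun i => propViol α β (s i / t i)) :=
    Finset.le_sup' (fun i => propViol α β (s i / t i)) (Finset.mem_univ i)
  intro j
  rw [hv j]
  split_ifs with hj
  · exact propViol_sum_div_sum_le hj (fun i _ => ht i) fun i _ => hle i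
  · exact (propViol_nonneg _ _ _).trans (hle (Classical.arbitrary I))
end

section
/- Let n, k, l be natural numbers with k ≥ 1, let σ : Fin n → Fin l be an attribute map, and let w : Fin n → Fin k → ℝ be a cost function with w m i ≥ 0 for all m, i. For j ≤ n and a matrix P : Fin k → Fin l → ℕ, let V(j,P) be the set of maps φ : Fin j → Fin k such that for all i ∈ Fin k and a ∈ Fin l, P i a equals the number of m ∈ Fin j with φ m = i and σ m = a; when V(j,P) is nonempty, let OPT(j,P) be the minimum over φ ∈ V(j,P) of Σ_{m∈Fin j} w m (φ m). Then for every j with 1 ≤ j ≤ n and every P with V(j,P) nonempty, writing a := σ(j−1) and letting P_i denote the matrix equal to P except that entry (i,a) is decreased by 1, one has OPT(j,P) = min over all i ∈ Fin k with P i a > 0 of ( OPT(j−1, P_i) + w (j−1) i ). -/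
/-- The number of points with attribute `a` that the assignment `φ` puts in cluster `i`. -/
def patternCount {ι A B : Type*} [Fintype ι] [DecidableEq A] [DecidableEq B]
    (σ : ι → A) (φ : ι → B) (i : B) (a : A) : ℕ :=
  (Finset.univ.filter (fun m : ι => φ m = i ∧ σ m = a)).card

section patternCount

variable {A B : Type*} [DecidableEq A] [DecidableEq B]

theorem patternCount_castSucc {j : ℕ} (σ : Fin (j + 1) → A) (φ : Fin (j + 1) → B) (i : B) (a : A) :
    patternCount σ φ i a =
      patternCount (fun m : Fin j => σ m.castSucc) (fun m => φ m.castSucc) i a +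
        if φ (Fin.last j) = i ∧ σ (Fin.last j) = a then 1 else 0 := by
  simp only [patternCount, Finset.card_filter, Fin.sum_univ_castSucc]

theorem patternCount_comp_perm {ι : Type*} [Fintype ι] (σ : ι → A) (φ : ι → B)
    (e : Equiv.Perm ι) (he : ∀ m, σ (e m) = σ m) (i : B) (a : A) :
    patternCount σ (fun m => φ (e m)) i a = patternCount σ φ i a := by
  simp only [patternCount, Finset.card_filter]
  rw [← Equiv.sum_comp e (fun m => if φ m = i ∧ σ m = a then 1 else 0)]
  simp only [he]

/-- An assignment has pattern `P` iff removing its last point leaves an assignment whose pattern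
is `P` with the entry of the last point decreased by one. -/
theorem eq_patternCount_iff {j : ℕ} (σ : Fin (j + 1) → A) (φ : Fin (j + 1) → B) (P : B → A → ℕ) :
    (∀ i a, P i a = patternCount σ φ i a) ↔
      0 < P (φ (Fin.last j)) (σ (Fin.last j)) ∧
        ∀ i a, (if i = φ (Fin.last j) ∧ a = σ (Fin.last j) then P i a - 1 else P i a) =
          patternCount (fun m : Fin j => σ m.castSucc) (fun m => φ m.castSucc) i a := by
  simp only [patternCount_castSucc]
  constructor
  · intro h
    refine ⟨by simp [h], fun i a => ?_⟩
    have := h i a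
    grind
  · rintro ⟨h0, h⟩ i a
    have := h i a
    grind

/-- If some point with the attribute of the last point can be put in cluster `i`, then the last
point itself can be put there without changing the pattern. -/
theorem exists_patternCount_eq_last {j : ℕ} (σ : Fin (j + 1) → A) (φ : Fin (j + 1) → B) (i : B)
    (hi : 0 < patternCount σ φ i (σ (Fin.last j))) :
    ∃ ψ : Fin (j + 1) → B, ψ (Fin.last j) = i ∧
      ∀ i' a, patternCount σ ψ i' a = patternCount σ φ i' a := by
  obtain ⟨m, hm⟩ := Finset.card_pos.mp hi
  obtain ⟨hφ, hσ⟩ := (Finset.mem_filter.mp hm).2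
  refine ⟨fun x => φ (Equiv.swap m (Fin.last j) x), by simpa using hφ,
    patternCount_comp_perm σ φ _ fun x => ?_⟩
  rw [Equiv.swap_apply_def]
  split_ifs with h₁ h₂
  · rw [h₁, hσ]
  · rw [h₂, hσ]
  · rfl

end patternCount

/-- Bellman recurrence for the dynamic programming algorithm on patterns.
`V j hj P` is the set of assignments of the first `j` points whose pattern is `P`,
and `OPT j hj P` is the minimum assignment cost over `V j hj P` (specified via
`IsLeast` whenever `V j hj P` is nonempty). Then for `1 ≤ j ≤ n` and any pattern `P`
realizable by the first `j` points, `OPT j P` is the minimum, over clusters `i`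
with `P i a > 0` (where `a = σ (j−1)`), of `OPT (j−1) Pᵢ + w (j−1) i`, where `Pᵢ`
is `P` with entry `(i, a)` decreased by one. -/
theorem dynProg_recurrence (n k l : ℕ) (hk : 1 ≤ k) (σ : Fin n → Fin l)
    (w : Fin n → Fin k → ℝ) (hw : ∀ m i, 0 ≤ w m i)
    (V : (j : ℕ) → j ≤ n → (Fin k → Fin l → ℕ) → Set (Fin j → Fin k))
    (hV : ∀ (j : ℕ) (hj : j ≤ n) (P : Fin k → Fin l → ℕ),
      V j hj P = {φ : Fin j → Fin k | ∀ (i : Fin k) (a : Fin l),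
        P i a = (Finset.univ.filter
          (fun m : Fin j => φ m = i ∧ σ (Fin.castLE hj m) = a)).card})
    (OPT : (j : ℕ) → j ≤ n → (Fin k → Fin l → ℕ) → ℝ)
    (hOPT : ∀ (j : ℕ) (hj : j ≤ n) (P : Fin k → Fin l → ℕ), (V j hj P).Nonempty →
      IsLeast {c : ℝ | ∃ φ ∈ V j hj P, c = ∑ m : Fin j, w (Fin.castLE hj m) (φ m)}
        (OPT j hj P)) :
    ∀ (j : ℕ) (hj1 : 1 ≤ j) (hj : j ≤ n) (P : Fin k → Fin l → ℕ),
      (V j hj P).Nonempty →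
      IsLeast {c : ℝ | ∃ i : Fin k,
          0 < P i (σ ⟨j - 1, by omega⟩) ∧
          c = OPT (j - 1) (by omega)
                (fun i' a' => if i' = i ∧ a' = σ ⟨j - 1, by omega⟩
                  then P i' a' - 1 else P i' a')
              + w ⟨j - 1, by omega⟩ i}
        (OPT j hj P) := by
  intro j hj1 hj P hne
  obtain ⟨j, rfl⟩ := Nat.exists_eq_add_of_le' hj1
  simp only [Nat.add_sub_cancel]
  have hj' : j ≤ n := by omega
  let dec (i : Fin k) : Fin k → Fin l → ℕ := fun i' a' =>
    if i' = i ∧ a' = σ ⟨j, hj⟩ then P i' a' - 1 else P i' a'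
  have mem_V_succ (φ : Fin (j + 1) → Fin k) : φ ∈ V (j + 1) hj P ↔
      0 < P (φ (Fin.last j)) (σ ⟨j, hj⟩) ∧
        (fun m : Fin j => φ m.castSucc) ∈ V j hj' (dec (φ (Fin.last j))) := by
    rw [hV, hV]
    exact eq_patternCount_iff (fun m => σ (Fin.castLE hj m)) φ P
  have cost_succ (φ : Fin (j + 1) → Fin k) :
      ∑ m : Fin (j + 1), w (Fin.castLE hj m) (φ m) =
        ∑ m : Fin j, w (Fin.castLE hj' m) (φ m.castSucc) + w ⟨j, hj⟩ (φ (Fin.last j)) :=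
    Fin.sum_univ_castSucc _
  obtain ⟨⟨φ, hφ, hφ_cost⟩, hmin⟩ := hOPT (j + 1) hj P hne
  have le_OPT (i : Fin k) (hi : 0 < P i (σ ⟨j, hj⟩)) :
      OPT (j + 1) hj P ≤ OPT j hj' (dec i) + w ⟨j, hj⟩ i := by
    have hφ_pattern := hφ
    rw [hV] at hφ_pattern
    obtain ⟨ψ, rfl, hψ⟩ := exists_patternCount_eq_last (fun m => σ (Fin.castLE hj m)) φ i
      (hi.trans_eq (hφ_pattern i _))
    have hψ_mem : ψ ∈ V (j + 1) hj P := by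
      rw [hV]
      exact fun i' a => (hφ_pattern i' a).trans (hψ i' a).symm
    obtain ⟨⟨χ, hχ, hχ_cost⟩, -⟩ := hOPT j hj' _ ⟨_, ((mem_V_succ ψ).1 hψ_mem).2⟩
    rw [hχ_cost]
    refine hmin ⟨Fin.snoc (α := fun _ => Fin k) χ (ψ (Fin.last j)), (mem_V_succ _).2 ?_, ?_⟩
    · simpa using ⟨hi, hχ⟩
    · simp [cost_succ]
  obtain ⟨hpos, hinit⟩ := (mem_V_succ φ).1 hφ
  refine ⟨⟨φ (Fin.last j), hpos, le_antisymm (le_OPT _ hpos) ?_⟩, ?_⟩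
  · rw [hφ_cost, cost_succ]
    gcongr
    exact (hOPT j hj' _ ⟨_, hinit⟩).2 ⟨_, hinit, rfl⟩
  · rintro _ ⟨i, hi, rfl⟩
    exact le_OPT i hi
end

section
/- Let (E, d) be a metric space, X a finite subset of E, and S*, S nonempty finite subsets of E. Let φ* : X → S* and φ : X → S be maps, and let α ≥ 0 satisfy Σ_{x∈X} d(x, φ(x)) ≤ α · Σ_{x∈X} d(x, φ*(x)). Then there exists a map g : S* → S with g(y) ∈ S for all y such that the composite φ' := g ∘ φ* satisfies Σ_{x∈X} d(x, φ'(x)) ≤ (2 + α) · Σ_{x∈X} d(x, φ*(x)). -/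
/-- Core of Theorem 3.2 (k-median case): given any clustering map `φ*` into centers
`S*` and an `α`-approximate vanilla clustering map `φ` into centers `S`, there is a
rerouting map `g : S* → S` such that the composite assignment `φ' = g ∘ φ*` has
cost at most `(2 + α)` times the cost of `φ*`. -/
theorem reroute_cost_bound {E : Type*} [MetricSpace E] (X : Finset E)
    (Sstar S : Finset E) (hSstar : Sstar.Nonempty) (hS : S.Nonempty)
    (φstar φ : E → E)
    (hφstar : ∀ x ∈ X, φstar x ∈ Sstar) (hφ : ∀ x ∈ X, φ x ∈ S)
    (α : ℝ) (hα : 0 ≤ α)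
    (happrox : ∑ x ∈ X, dist x (φ x) ≤ α * ∑ x ∈ X, dist x (φstar x)) :
    ∃ g : E → E, (∀ y ∈ Sstar, g y ∈ S) ∧
      ∑ x ∈ X, dist x (g (φstar x)) ≤ (2 + α) * ∑ x ∈ X, dist x (φstar x) := by
  choose g hgS hg using fun y : E => S.exists_min_image (dist y) hS
  refine ⟨g, fun y _ => hgS y, ?_⟩
  have key : ∀ x ∈ X, dist x (g (φstar x)) ≤ 2 * dist x (φstar x) + dist x (φ x) := by
    intro x hx
    have hnear := hg (φstar x) (φ x) (hφ x hx)
    have htri := dist_triangle x (φstar x) (g (φstar x))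
    have htri' := dist_triangle_left (φstar x) (φ x) x
    linarith
  calc ∑ x ∈ X, dist x (g (φstar x))
      ≤ ∑ x ∈ X, (2 * dist x (φstar x) + dist x (φ x)) := Finset.sum_le_sum key
    _ = 2 * ∑ x ∈ X, dist x (φstar x) + ∑ x ∈ X, dist x (φ x) := by
      rw [Finset.sum_add_distrib, Finset.mul_sum]
    _ ≤ (2 + α) * ∑ x ∈ X, dist x (φstar x) := by linarith
end

section
/- Let X be a finite set, σ : X → Fin 2 an attribute map, k ≥ 1, and w : X → Fin k → ℝ a cost function with w x i ≥ 0 for all x, i. Let φ : X → Fin k be an assignment and let F := Σ_{i∈Fin k} | #{x ∈ X : φ x = i ∧ σ x = 0} − #{x ∈ X : φ x = i ∧ σ x = 1} | be its sum of imbalances. Then there exist a set M of pairwise disjoint unordered pairs {u, v} of elements of X with σ u ≠ σ v, and a set U consisting of the points of X not covered by any pair of M, such that |U| = F and Σ_{{u,v}∈M} min_{i∈Fin k} (w u i + w v i) + Σ_{u∈U} min_{i∈Fin k} w u i ≤ Σ_{x∈X} w x (φ x). -/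
/-- The minimum of a cost function over the `k` clusters (for `k ≥ 1`). -/
noncomputable def minCost {k : ℕ} (hk : 1 ≤ k) (f : Fin k → ℝ) : ℝ :=
  Finset.univ.inf' ⟨⟨0, hk⟩, Finset.mem_univ _⟩ f

theorem minCost_le {k : ℕ} (hk : 1 ≤ k) (f : Fin k → ℝ) (i : Fin k) : minCost hk f ≤ f i :=
  Finset.inf'_le _ (Finset.mem_univ i)

/-- If no cluster contains points of both attributes, the sum of imbalances is the number of
points. -/
theorem sum_imbalance_eq_card {X ι : Type*} [DecidableEq X] [Fintype ι] [DecidableEq ι]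
    (σ : X → Fin 2) (φ : X → ι) (S : Finset X)
    (h : ∀ u ∈ S, ∀ v ∈ S, φ u = φ v → σ u = 0 → σ v ≠ 1) :
    ∑ i : ι, |((S.filter (fun x => φ x = i ∧ σ x = 0)).card : ℤ) -
        ((S.filter (fun x => φ x = i ∧ σ x = 1)).card : ℤ)| = S.card := by
  rw [Finset.card_eq_sum_card_fiberwise (f := φ) (t := Finset.univ) (by simp)]
  push_cast
  refine Finset.sum_congr rfl fun i _ => ?_
  have hsplit : (S.filter (fun x => φ x = i)).card =
      (S.filter (fun x => φ x = i ∧ σ x = 0)).card +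
        (S.filter (fun x => φ x = i ∧ σ x = 1)).card := by
    rw [← Finset.card_union_of_disjoint]
    · congr 1
      ext x
      have : σ x = 0 ∨ σ x = 1 := by omega
      simp only [Finset.mem_union, Finset.mem_filter]
      tauto
    · rw [Finset.disjoint_filter]
      rintro x _ ⟨_, h0⟩ ⟨_, h1⟩
      simp [h0] at h1
  have hzero : (S.filter (fun x => φ x = i ∧ σ x = 0)).card = 0 ∨
      (S.filter (fun x => φ x = i ∧ σ x = 1)).card = 0 := by
    by_contra! hne
    obtain ⟨u, hu⟩ := Finset.card_ne_zero.1 hne.1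
    obtain ⟨v, hv⟩ := Finset.card_ne_zero.1 hne.2
    rw [Finset.mem_filter] at hu hv
    exact h u hu.1 v hv.1 (hu.2.1.trans hv.2.1.symm) hu.2.2 hv.2.2
  rw [hsplit]
  rcases hzero with h0 | h0 <;> simp [h0]

/-- Adding two points of opposite attributes to one cluster leaves every imbalance unchanged. -/
theorem imbalance_insert_insert {X ι : Type*} [DecidableEq X] [DecidableEq ι]
    (σ : X → Fin 2) (φ : X → ι) (S : Finset X) {u v : X} (hu : u ∉ S) (hv : v ∉ S)
    (hφ : φ u = φ v) (hσu : σ u = 0) (hσv : σ v = 1) (i : ι) :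
    (((insert u (insert v S)).filter (fun x => φ x = i ∧ σ x = 0)).card : ℤ) -
        (((insert u (insert v S)).filter (fun x => φ x = i ∧ σ x = 1)).card : ℤ) =
      ((S.filter (fun x => φ x = i ∧ σ x = 0)).card : ℤ) -
        ((S.filter (fun x => φ x = i ∧ σ x = 1)).card : ℤ) := by
  by_cases hi : φ v = i <;>
    simp [Finset.filter_insert, hφ, hσu, hσv, hi, hu, hv]

/-- The pairing of a finite set of points obtained by matching points of opposite attributes
inside each cluster. -/
theorem exists_pairing_of_assignment {X : Type*} [DecidableEq X]
    {k : ℕ} (hk : 1 ≤ k) (σ : X → Fin 2) (w : X → Fin k → ℝ) (φ : X → Fin k) (S : Finset X) :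
    ∃ (M : Finset (X × X)) (U : Finset X),
      (∀ p ∈ M, p.1 ∈ S ∧ p.2 ∈ S) ∧
      (∀ p ∈ M, σ p.1 ≠ σ p.2) ∧
      (∀ p ∈ M, ∀ q ∈ M, p ≠ q →
        p.1 ≠ q.1 ∧ p.1 ≠ q.2 ∧ p.2 ≠ q.1 ∧ p.2 ≠ q.2) ∧
      U = S.filter (fun x => ∀ p ∈ M, x ≠ p.1 ∧ x ≠ p.2) ∧
      (U.card : ℤ) = ∑ i : Fin k, |((S.filter (fun x => φ x = i ∧ σ x = 0)).card : ℤ) -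
        ((S.filter (fun x => φ x = i ∧ σ x = 1)).card : ℤ)| ∧
      (∑ p ∈ M, minCost hk (fun i => w p.1 i + w p.2 i)) +
          (∑ u ∈ U, minCost hk (fun i => w u i)) ≤
        ∑ x ∈ S, w x (φ x) := by
  induction S using Finset.strongInduction with
  | H S ih =>
  by_cases h : ∀ u ∈ S, ∀ v ∈ S, φ u = φ v → σ u = 0 → σ v ≠ 1
  · refine ⟨∅, S, by simp, by simp, by simp, by simp,
      (sum_imbalance_eq_card σ φ S h).symm, ?_⟩
    simpa using Finset.sum_le_sum fun x _ => minCost_le hk (w x) (φ x)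
  push Not at h
  obtain ⟨u, huS, v, hvS, hφ, hσu, hσv⟩ := h
  have huv : u ≠ v := by
    rintro rfl
    simp [hσu] at hσv
  obtain ⟨T, rfl, hu, hv⟩ : ∃ T, S = insert u (insert v T) ∧ u ∉ T ∧ v ∉ T :=
    ⟨(S.erase u).erase v, by grind, by simp, by simp⟩
  obtain ⟨M, U, hMT, hMσ, hMd, hU, hcard, hcost⟩ := ih T
    ⟨by grind, fun hsub => hu (hsub huS)⟩
  have huvM : (u, v) ∉ M := fun hm => hu (hMT _ hm).1
  refine ⟨insert (u, v) M, U, by grind, ?_, ?_, ?_, ?_, ?_⟩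
  · simp only [Finset.forall_mem_insert]
    exact ⟨by simp [hσu, hσv], hMσ⟩
  · grind
  · ext x
    simp only [hU, Finset.mem_filter, Finset.mem_insert]
    grind
  · simp_rw [imbalance_insert_insert σ φ T hu hv hφ hσu hσv]
    exact hcard
  · rw [Finset.sum_insert huvM, Finset.sum_insert (by simp [huv, hu]), Finset.sum_insert hv]
    have := minCost_le hk (fun i => w u i + w v i) (φ v)
    rw [hφ]
    linarith

/-- From an assignment to a partial pairing (Theorem 3.4, forward direction): any
assignment `φ` with sum of imbalances `F` yields a set `M` of pairwise disjoint
pairs of points of opposite attributes, leaving a set `U` of exactly `F` uncovered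
points, whose total weight (each pair weighted by its cheapest common center, each
uncovered point by its cheapest center) is at most the cost of `φ`. -/
theorem assignment_to_matching {X : Type*} [Fintype X] [DecidableEq X]
    (k : ℕ) (hk : 1 ≤ k) (σ : X → Fin 2) (w : X → Fin k → ℝ)
    (hw : ∀ x i, 0 ≤ w x i) (φ : X → Fin k) (F : ℤ)
    (hF : F = ∑ i : Fin k,
      |((Finset.univ.filter (fun x => φ x = i ∧ σ x = 0)).card : ℤ) -
        ((Finset.univ.filter (fun x => φ x = i ∧ σ x = 1)).card : ℤ)|) :
    ∃ (M : Finset (X × X)) (U : Finset X),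
      (∀ p ∈ M, σ p.1 ≠ σ p.2) ∧
      (∀ p ∈ M, ∀ q ∈ M, p ≠ q →
        p.1 ≠ q.1 ∧ p.1 ≠ q.2 ∧ p.2 ≠ q.1 ∧ p.2 ≠ q.2) ∧
      U = Finset.univ.filter (fun x => ∀ p ∈ M, x ≠ p.1 ∧ x ≠ p.2) ∧
      (U.card : ℤ) = F ∧
      (∑ p ∈ M, minCost hk (fun i => w p.1 i + w p.2 i)) +
          (∑ u ∈ U, minCost hk (fun i => w u i)) ≤
        ∑ x : X, w x (φ x) := by
  obtain ⟨M, U, -, hσ, hM, hU, hcard, hcost⟩ :=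
    exists_pairing_of_assignment hk σ w φ Finset.univ
  exact ⟨M, U, hσ, hM, by convert hU, hcard.trans hF.symm, hcost⟩
end

section
/- Let X be a finite set, σ : X → Fin 2 an attribute map, k ≥ 1, and w : X → Fin k → ℝ a cost function with w x i ≥ 0 for all x, i. Suppose X is partitioned into a set M of pairwise disjoint unordered pairs {u, v} with σ u ≠ σ v and a set U of F points not covered by any pair of M. Then there exists an assignment φ : X → Fin k such that Σ_{x∈X} w x (φ x) = Σ_{{u,v}∈M} min_{i∈Fin k} (w u i + w v i) + Σ_{u∈U} min_{i∈Fin k} w u i, and the sum of imbalances of φ, namely Σ_{i∈Fin k} | #{x : φ x = i ∧ σ x = 0} − #{x : φ x = i ∧ σ x = 1} |, is at most F. -/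
/-- The minimum defining `minCost` is attained. -/
theorem exists_eq_minCost {k : ℕ} (hk : 1 ≤ k) (f : Fin k → ℝ) :
    ∃ i, f i = minCost hk f := by
  obtain ⟨i, -, hi⟩ := Finset.exists_mem_eq_inf' ⟨⟨0, hk⟩, Finset.mem_univ _⟩ f
  exact ⟨i, hi.symm⟩

/-- A sum over all points splits into the sum over disjoint pairs and the sum over the
points that no pair covers. -/
theorem sum_eq_sum_pairs_add_sum_uncovered {X A : Type*} [Fintype X] [DecidableEq X]
    [AddCommMonoid A] (M : Finset (X × X)) (hne : ∀ p ∈ M, p.1 ≠ p.2)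
    (hdisj : ∀ p ∈ M, ∀ q ∈ M, p ≠ q →
      p.1 ≠ q.1 ∧ p.1 ≠ q.2 ∧ p.2 ≠ q.1 ∧ p.2 ≠ q.2) (f : X → A) :
    ∑ x, f x = ∑ p ∈ M, (f p.1 + f p.2) +
      ∑ u ∈ Finset.univ.filter (fun x => ∀ p ∈ M, x ≠ p.1 ∧ x ≠ p.2), f u := by
  have hcompl : Finset.univ.filter (fun x => ∀ p ∈ M, x ≠ p.1 ∧ x ≠ p.2) =
      (M.biUnion fun p => {p.1, p.2})ᶜ := by
    ext x
    simp only [Finset.mem_filter_univ, Finset.mem_compl, Finset.mem_biUnion,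
      Finset.mem_insert, Finset.mem_singleton, not_exists, not_and, not_or, ne_eq]
  have hpairs : ∑ x ∈ M.biUnion (fun p => {p.1, p.2}), f x = ∑ p ∈ M, (f p.1 + f p.2) := by
    rw [Finset.sum_biUnion]
    · exact Finset.sum_congr rfl fun p hp => Finset.sum_pair (hne p hp)
    · intro p hp q hq hpq
      obtain ⟨h₁, h₂, h₃, h₄⟩ := hdisj p hp q hq hpq
      simp [Function.onFun, h₁.symm, h₂.symm, h₃.symm, h₄.symm]
  rw [hcompl, ← hpairs, Finset.sum_add_sum_compl]

/-- A value prescribed on each of a family of disjoint pairs extends to a function that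
agrees with a given one off the pairs. -/
theorem exists_extend_pairs {X B : Type*} (M : Finset (X × X))
    (hdisj : ∀ p ∈ M, ∀ q ∈ M, p ≠ q →
      p.1 ≠ q.1 ∧ p.1 ≠ q.2 ∧ p.2 ≠ q.1 ∧ p.2 ≠ q.2) (c : X × X → B) (d : X → B) :
    ∃ φ : X → B, (∀ p ∈ M, φ p.1 = c p ∧ φ p.2 = c p) ∧
      ∀ x, (∀ p ∈ M, x ≠ p.1 ∧ x ≠ p.2) → φ x = d x := by
  have h : ∀ x, ∃ b, (∀ p ∈ M, x = p.1 ∨ x = p.2 → b = c p) ∧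
      ((∀ p ∈ M, x ≠ p.1 ∧ x ≠ p.2) → b = d x) := by
    intro x
    by_cases hx : ∃ p ∈ M, x = p.1 ∨ x = p.2
    · obtain ⟨p, hp, hxp⟩ := hx
      refine ⟨c p, fun q hq hxq => ?_, fun h => ?_⟩
      · by_cases hpq : p = q
        · rw [hpq]
        · have := hdisj p hp q hq hpq
          grind
      · have := h p hp
        tauto
    · exact ⟨d x, fun p hp hxp => (hx ⟨p, hp, hxp⟩).elim, fun _ => rfl⟩
  choose φ hφ using h
  exact ⟨φ, fun p hp => ⟨(hφ p.1).1 p hp (Or.inl rfl), (hφ p.2).1 p hp (Or.inr rfl)⟩,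
    fun x => (hφ x).2⟩

/-- From a partial pairing to an assignment (Theorem 3.4, converse direction):
given a set `M` of pairwise disjoint pairs of points of opposite attributes and the
set `U` of the `F` points not covered by `M`, there is an assignment `φ` whose cost
equals the weight of the pairing (each pair assigned to its cheapest common center,
each uncovered point to its cheapest center) and whose sum of imbalances is at most
`F = |U|`. -/
theorem matching_to_assignment {X : Type*} [Fintype X] [DecidableEq X]
    (k : ℕ) (hk : 1 ≤ k) (σ : X → Fin 2) (w : X → Fin k → ℝ)
    (hw : ∀ x i, 0 ≤ w x i)
    (M : Finset (X × X)) (U : Finset X)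
    (hσM : ∀ p ∈ M, σ p.1 ≠ σ p.2)
    (hdisj : ∀ p ∈ M, ∀ q ∈ M, p ≠ q →
      p.1 ≠ q.1 ∧ p.1 ≠ q.2 ∧ p.2 ≠ q.1 ∧ p.2 ≠ q.2)
    (hU : U = Finset.univ.filter (fun x => ∀ p ∈ M, x ≠ p.1 ∧ x ≠ p.2)) :
    ∃ φ : X → Fin k,
      (∑ x : X, w x (φ x)) =
        (∑ p ∈ M, minCost hk (fun i => w p.1 i + w p.2 i)) +
          (∑ u ∈ U, minCost hk (fun i => w u i)) ∧
      (∑ i : Fin k,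
        |((Finset.univ.filter (fun x => φ x = i ∧ σ x = 0)).card : ℤ) -
          ((Finset.univ.filter (fun x => φ x = i ∧ σ x = 1)).card : ℤ)|) ≤
        (U.card : ℤ) := by
  have hne : ∀ p ∈ M, p.1 ≠ p.2 := fun p hp h => hσM p hp (congrArg σ h)
  choose c hc using fun p : X × X => exists_eq_minCost hk fun i => w p.1 i + w p.2 i
  choose d hd using fun x : X => exists_eq_minCost hk (w x)
  obtain ⟨φ, hφM, hφU⟩ := exists_extend_pairs M hdisj c d
  refine ⟨φ, ?_, ?_⟩
  · rw [sum_eq_sum_pairs_add_sum_uncovered M hne hdisj, ← hU]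
    congr 1
    · refine Finset.sum_congr rfl fun p hp => ?_
      rw [(hφM p hp).1, (hφM p hp).2]
      exact hc p
    · refine Finset.sum_congr rfl fun u hu => ?_
      rw [hU, Finset.mem_filter_univ] at hu
      rw [hφU u hu]
      exact hd u
  · let g : Fin k → X → ℤ := fun i x =>
      (if φ x = i ∧ σ x = 0 then 1 else 0) - (if φ x = i ∧ σ x = 1 then 1 else 0)
    have hg : ∀ i, ((Finset.univ.filter (fun x => φ x = i ∧ σ x = 0)).card : ℤ) -
        ((Finset.univ.filter (fun x => φ x = i ∧ σ x = 1)).card : ℤ) = ∑ u ∈ U, g i u := by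
      intro i
      have hcancel : ∑ p ∈ M, (g i p.1 + g i p.2) = 0 := by
        refine Finset.sum_eq_zero fun p hp => ?_
        have := hσM p hp
        simp only [g, (hφM p hp).1, (hφM p hp).2]
        grind
      rw [Finset.natCast_card_filter, Finset.natCast_card_filter, ← Finset.sum_sub_distrib,
        sum_eq_sum_pairs_add_sum_uncovered M hne hdisj, ← hU]
      exact add_eq_right.2 hcancel
    simp only [hg]
    calc ∑ i, |∑ u ∈ U, g i u|
      _ ≤ ∑ i, ∑ u ∈ U, if φ u = i then (1 : ℤ) else 0 := by
        refine Finset.sum_le_sum fun i _ => (Finset.abs_sum_le_sum_abs _ _).trans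
          (Finset.sum_le_sum fun u _ => ?_)
        by_cases h : φ u = i
        · simp only [g, h, true_and, if_true]
          split_ifs <;> decide
        · simp [g, h]
      _ = U.card := by
        rw [Finset.sum_comm]
        simp
end

section
/- Say a matrix P : Fin k → Fin l → ℕ is obtained from P' : Fin k → Fin l → ℕ by a single merge if there exist indices i ≠ i' such that rows i and i' of P' are both nonzero, row i of P equals the entrywise sum of rows i and i' of P', row i' of P is zero, and all other rows of P and P' agree; say P' is a refinement of P if P is reachable from P' by a finite (possibly empty) sequence of single merges. Let X be a finite set, σ : X → Fin l an attribute map, E a type, w : X → E → ℝ a cost function, c : Fin k → E centers, and φ : X → Fin k an assignment with pattern P^φ (where P^φ i a = #{x : φ x = i ∧ σ x = a}). If P' is a refinement of P^φ, then there exist an assignment φ' : X → Fin k and centers c' : Fin k → E with {c' i : i ∈ Fin k} ⊆ {c i : i ∈ Fin k}, such that P^{φ'} = P' and Σ_{x∈X} w x (c' (φ' x)) = Σ_{x∈X} w x (c (φ x)). -/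
/-- The pattern of an assignment `φ` with attribute map `σ`: entry `(i, a)` counts
the points of attribute `a` assigned to cluster `i`. -/
def pattern {X : Type*} [Fintype X] {k l : ℕ} (σ : X → Fin l) (φ : X → Fin k) :
    Fin k → Fin l → ℕ :=
  fun i a => (Finset.univ.filter (fun x => φ x = i ∧ σ x = a)).card

/-- `P` is obtained from `P'` by a single merge: two nonzero rows `i ≠ i'` of `P'`
are replaced by their entrywise sum (placed in row `i`) and a zero row (in row
`i'`), all other rows being unchanged. -/
def SingleMerge {k l : ℕ} (P P' : Fin k → Fin l → ℕ) : Prop :=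
  ∃ i i' : Fin k, i ≠ i' ∧ (∃ a, P' i a ≠ 0) ∧ (∃ a, P' i' a ≠ 0) ∧
    (∀ a, P i a = P' i a + P' i' a) ∧ (∀ a, P i' a = 0) ∧
    (∀ i'' : Fin k, i'' ≠ i → i'' ≠ i' → ∀ a, P i'' a = P' i'' a)

/-- `P'` is a refinement of `P`: `P` is reachable from `P'` by a finite (possibly
empty) sequence of single merges. -/
def IsRefinement {k l : ℕ} (P' P : Fin k → Fin l → ℕ) : Prop :=
  Relation.ReflTransGen (fun Q Q' => SingleMerge Q' Q) P' P

/-- A single merge of patterns can be undone by moving part of the merged cluster to the empty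
one, placing the center of the merged cluster there too. -/
theorem SingleMerge.exists_reassignment {X : Type*} [Fintype X] {k l : ℕ} {E : Type*}
    {σ : X → Fin l} {φ : X → Fin k} {P' : Fin k → Fin l → ℕ}
    (h : SingleMerge (pattern σ φ) P') (c : Fin k → E) :
    ∃ (φ' : X → Fin k) (c' : Fin k → E),
      (∀ i : Fin k, ∃ i₀ : Fin k, c' i = c i₀) ∧ pattern σ φ' = P' ∧
      ∀ x, c' (φ' x) = c (φ x) := by
  classical
  obtain ⟨i, i', hne, -, -, hsum, hzero, hrest⟩ := h
  have hT : ∀ a, ∃ T ⊆ Finset.univ.filter (fun x => φ x = i ∧ σ x = a), T.card = P' i' a :=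
    fun a => Finset.exists_subset_card_eq ((Nat.le_add_left _ _).trans_eq (hsum a).symm)
  choose T hTsub hTcard using hT
  have hmem : ∀ {a x}, x ∈ T a → φ x = i ∧ σ x = a := fun hx => by
    simpa using hTsub _ hx
  have hempty : ∀ x, φ x ≠ i' := fun x hx => by
    have := hzero (σ x)
    rw [pattern, Finset.card_eq_zero, Finset.filter_eq_empty_iff] at this
    exact this (Finset.mem_univ x) ⟨hx, rfl⟩
  refine ⟨fun x => if x ∈ T (σ x) then i' else φ x, Function.update c i' (c i), ?_, ?_, ?_⟩
  · intro j
    by_cases hj : j = i'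
    · exact ⟨i, by simp [hj]⟩
    · exact ⟨j, by simp [hj]⟩
  · funext j a
    by_cases hj' : j = i'
    · subst hj'
      rw [← hTcard a, pattern]
      congr 1
      ext x
      grind
    by_cases hj : j = i
    · subst hj
      have hcard := Finset.card_sdiff_add_card_eq_card (hTsub a)
      have hs : (Finset.univ.filter (fun x => φ x = j ∧ σ x = a)).card = P' j a + P' i' a :=
        hsum a
      have hdiff : Finset.univ.filter
          (fun x => (if x ∈ T (σ x) then i' else φ x) = j ∧ σ x = a) =
          Finset.univ.filter (fun x => φ x = j ∧ σ x = a) \ T a := by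
        ext x
        grind
      rw [pattern, hdiff]
      have := hTcard a
      omega
    · rw [← hrest j hj hj' a, pattern, pattern]
      congr 1
      ext x
      grind
  · intro x
    by_cases hx : x ∈ T (σ x)
    · simp [hx, (hmem hx).1]
    · simp [hx, hempty x]

/-- A refinement of the pattern of an assignment is the pattern of a reassignment under which
every point keeps its center. -/
theorem IsRefinement.exists_reassignment {X : Type*} [Fintype X] {k l : ℕ} {E : Type*}
    {σ : X → Fin l} {φ : X → Fin k} {P' : Fin k → Fin l → ℕ}
    (h : IsRefinement P' (pattern σ φ)) (c : Fin k → E) :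
    ∃ (φ' : X → Fin k) (c' : Fin k → E),
      (∀ i : Fin k, ∃ i₀ : Fin k, c' i = c i₀) ∧ pattern σ φ' = P' ∧
      ∀ x, c' (φ' x) = c (φ x) := by
  unfold IsRefinement at h
  induction h using Relation.ReflTransGen.head_induction_on with
  | refl => exact ⟨φ, c, fun i => ⟨i, rfl⟩, rfl, fun _ => rfl⟩
  | head hmerge _ ih =>
    obtain ⟨φ₁, c₁, hc₁, rfl, hφ₁⟩ := ih
    obtain ⟨φ₂, c₂, hc₂, hP, hφ₂⟩ := hmerge.exists_reassignment c₁
    refine ⟨φ₂, c₂, fun i => ?_, hP, fun x => (hφ₂ x).trans (hφ₁ x)⟩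
    obtain ⟨j, hj⟩ := hc₂ i
    exact (hc₁ j).imp fun _ => hj.trans

/-- Lemma B.2 (center reassignment): if `P'` is a refinement of the pattern of an
assignment `φ` with centers `c`, then there are an assignment `φ'` and centers `c'`
drawn from the centers `c` (with multiplicity) such that `φ'` has pattern `P'` and
the same cost as `φ`. -/
theorem center_reassignment {X : Type*} [Fintype X] {k l : ℕ} {E : Type*}
    (σ : X → Fin l) (w : X → E → ℝ) (c : Fin k → E) (φ : X → Fin k)
    (P' : Fin k → Fin l → ℕ) (href : IsRefinement P' (pattern σ φ)) :
    ∃ (φ' : X → Fin k) (c' : Fin k → E),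
      (∀ i : Fin k, ∃ i₀ : Fin k, c' i = c i₀) ∧
      pattern σ φ' = P' ∧
      ∑ x : X, w x (c' (φ' x)) = ∑ x : X, w x (c (φ x)) := by
  obtain ⟨φ', c', hc', hP, hφ'⟩ := href.exists_reassignment c
  exact ⟨φ', c', hc', hP, by simp only [hφ']⟩
end
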